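/- Let (Ω,μ) = ∏_{i=1}^n (Ω_i,μ_i) be a finite product probability space in which each factor Ω_i is linearly ordered, let A_1,…,A_k ⊆ Ω be events, define X(ω) = max{|I| : I ⊆ [k] and A_i, i ∈ I, occur disjointly at ω}, and set λ = Σ_{i=1}^k μ(A_i). Then for every positive integer t with t ≤ k, μ({ω : X(ω) ≥ λ + t}) ≤ ∏_{i=0}^{t−1} λ/(λ + t − i). -/

import Mathlib

open MeasureTheory

/-- The events `A j`, `j ∈ I`, occur disjointly at `ω`: there are pairwise disjoint
sets `S j ⊆ [n]` such that every `ω'` agreeing with `ω` on `S j` lies in `A j`. -/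
def OccurDisjointly {n : ℕ} {Ω : Fin n → Type*} {ι : Type*}
    (A : ι → Set (∀ i, Ω i)) (I : Finset ι) (ω : ∀ i, Ω i) : Prop :=
  ∃ S : ι → Finset (Fin n),
    (∀ j ∈ I, ∀ j' ∈ I, j ≠ j' → Disjoint (S j) (S j')) ∧
    ∀ j ∈ I, ∀ ω' : ∀ i, Ω i, (∀ i ∈ S j, ω' i = ω i) → ω' ∈ A j

/-- `X ω` is the maximum size of a set `I ⊆ [k]` such that the events
`A j`, `j ∈ I`, occur disjointly at `ω`. -/
noncomputable def maxDisjOcc {n k : ℕ} {Ω : Fin n → Type*}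
    (A : Fin k → Set (∀ i, Ω i)) (ω : ∀ i, Ω i) : ℕ :=
  sSup {m : ℕ | ∃ I : Finset (Fin k), I.card = m ∧ OccurDisjointly A I ω}

/-! ### The butterfly theorem on the discrete cube -/

/-- local factor of the test vectors -/
def rhoF (x : Bool) (s : Prop) [Decidable s] (y : Bool) : ℤ :=
  if x = y then 1 else if s then 0 else 2

/-- local factor of the positive definite form -/
def jF (y z : Bool) : ℤ := if y = z then 2 else -1

/-- local factor of the root of the form -/
def bF (p : Option Bool) (y : Bool) : ℤ :=
  match p with
  | some q => if q = y then 1 else 0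
  | none => if y then 1 else -1

lemma jF_eq (y z : Bool) : jF y z = ∑ p : Option Bool, bF p y * bF p z := by
  cases y <;> cases z <;> decide

lemma jF_prod_eq {n : ℕ} (y z : Fin n → Bool) :
    ∏ i, jF (y i) (z i)
      = ∑ P : Fin n → Option Bool, (∏ i, bF (P i) (y i)) * ∏ i, bF (P i) (z i) := by
  simp_rw [jF_eq, Fintype.prod_sum, Finset.prod_mul_distrib]

lemma jF_posdef {n : ℕ} (w : (Fin n → Bool) → ℤ)
    (h : ∑ y, ∑ z, w y * (∏ i, jF (y i) (z i)) * w z = 0) : w = 0 := by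
  have h2 : ∑ P : Fin n → Option Bool, (∑ y, (∏ i, bF (P i) (y i)) * w y) ^ 2 = 0 := by
    rw [← h]
    simp_rw [jF_prod_eq, sq, Finset.sum_mul_sum, Finset.mul_sum, Finset.sum_mul]
    rw [Finset.sum_comm]
    refine Finset.sum_congr rfl fun y _ => ?_
    rw [Finset.sum_comm]
    refine Finset.sum_congr rfl fun z _ => ?_
    refine Finset.sum_congr rfl fun P _ => ?_
    ring
  rw [Finset.sum_eq_zero_iff_of_nonneg (fun _ _ => sq_nonneg _)] at h2
  funext y
  have h3 := h2 (fun i => some (y i)) (Finset.mem_univ _)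
  have h4 : ∑ z, (∏ i, bF (some (y i)) (z i)) * w z = 0 := by
    simpa using h3
  rw [Finset.sum_eq_single y] at h4
  · simpa [bF] using h4
  · intro z _ hz
    obtain ⟨i, hi⟩ : ∃ i, z i ≠ y i := by
      by_contra! hc
      exact hz (funext hc)
    rw [Finset.prod_eq_zero (Finset.mem_univ i), zero_mul]
    simp [bF, hi.symm]
  · simp

/-- test vectors, as a matrix -/
def rMat {n : ℕ} (S : (Fin n → Bool) → Finset (Fin n)) :
    Matrix (Fin n → Bool) (Fin n → Bool) ℤ :=
  fun x y => ∏ i, rhoF (x i) (i ∈ S x) (y i)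

lemma rMat_det {n : ℕ} (S : (Fin n → Bool) → Finset (Fin n)) : (rMat S).det ≠ 0 := by
  intro h
  have h1 : (Int.castRingHom (ZMod 2)).mapMatrix (rMat S) = 1 := by
    ext x y
    simp only [RingHom.mapMatrix_apply, Matrix.map_apply, rMat, map_prod, Matrix.one_apply]
    split_ifs with hxy
    · subst hxy
      simp [rhoF]
    · obtain ⟨i, hi⟩ : ∃ i, x i ≠ y i := by
        by_contra! hc
        exact hxy (funext hc)
      apply Finset.prod_eq_zero (Finset.mem_univ i)
      simp only [rhoF, hi, if_false]
      split_ifs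
      · simp
      · decide
  have h2 := RingHom.map_det (Int.castRingHom (ZMod 2)) (rMat S)
  rw [h1, h] at h2
  simp at h2

lemma rMat_supp {n : ℕ} (S : (Fin n → Bool) → Finset (Fin n)) (x y : Fin n → Bool)
    (h : ¬ ∀ i ∈ S x, y i = x i) : rMat S x y = 0 := by
  push Not at h
  obtain ⟨i, hi, hne⟩ := h
  apply Finset.prod_eq_zero (Finset.mem_univ i)
  simp [rhoF, hi, hne.symm]

lemma rMat_J_supp {n : ℕ} (S : (Fin n → Bool) → Finset (Fin n)) (x y : Fin n → Bool)
    (h : ¬ ∀ i, i ∉ S x → y i = !(x i)) :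
    ∑ z, (∏ i, jF (y i) (z i)) * rMat S x z = 0 := by
  push Not at h
  obtain ⟨i, hi, hne⟩ := h
  simp only [rMat, ← Finset.prod_mul_distrib]
  rw [← Fintype.prod_sum (fun i b => jF (y i) b * rhoF (x i) (i ∈ S x) b)]
  apply Finset.prod_eq_zero (Finset.mem_univ i)
  have : y i = x i := by
    revert hne; cases y i <;> cases x i <;> simp
  rw [this]
  cases x i <;> simp [jF, rhoF, hi]

theorem butterfly {n : ℕ} (T : Finset (Fin n → Bool)) (S : (Fin n → Bool) → Finset (Fin n))
    (Z : Finset (Fin n → Bool))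
    (hZ : ∀ y, (∃ x ∈ T, ∀ i ∈ S x, y i = x i) → (∃ x ∈ T, ∀ i, i ∉ S x → y i = !(x i)) → y ∈ Z) :
    T.card ≤ Z.card := by
  classical
  let M : Matrix T Z ℤ := (rMat S).submatrix (fun x => x.1) (fun y => y.1)
  have hinj : Function.Injective M.vecMulLinear := by
    rw [injective_iff_map_eq_zero]
    intro β hβ
    let b : (Fin n → Bool) → ℤ := fun x => if h : x ∈ T then β ⟨x, h⟩ else 0
    let w : (Fin n → Bool) → ℤ := Matrix.vecMul b (rMat S)
    have hb : ∀ x, x ∉ T → b x = 0 := fun x hx => by simp [b, hx]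
    have hw : ∀ y, w y = ∑ x, b x * rMat S x y := fun y => rfl
    have hwZ : ∀ y ∈ Z, w y = 0 := by
      intro y hy
      have := congrFun hβ ⟨y, hy⟩
      rw [hw, ← Finset.sum_subset (Finset.subset_univ T)
        (fun x _ hx => by rw [hb x hx, zero_mul]), ← Finset.sum_coe_sort]
      simpa [Matrix.vecMul, dotProduct, M, b] using this
    have hw0 : w = 0 := by
      apply jF_posdef
      refine Finset.sum_eq_zero fun y _ => ?_
      simp_rw [mul_assoc]
      rw [← Finset.mul_sum]
      by_cases hR : ∃ x ∈ T, ∀ i ∈ S x, y i = x i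
      · by_cases hY : ∃ x ∈ T, ∀ i, i ∉ S x → y i = !(x i)
        · rw [hwZ y (hZ y hR hY), zero_mul]
        · have : ∑ z, (∏ i, jF (y i) (z i)) * w z = 0 := by
            simp_rw [hw, Finset.mul_sum]
            rw [Finset.sum_comm]
            refine Finset.sum_eq_zero fun x _ => ?_
            by_cases hx : x ∈ T
            · have := rMat_J_supp S x y (fun hc => hY ⟨x, hx, hc⟩)
              calc _ = b x * ∑ z, (∏ i, jF (y i) (z i)) * rMat S x z := by
                    rw [Finset.mul_sum]
                    exact Finset.sum_congr rfl fun z _ => by ring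
                _ = 0 := by rw [this, mul_zero]
            · simp [hb x hx]
          rw [this, mul_zero]
      · have : w y = 0 := by
          rw [hw]
          refine Finset.sum_eq_zero fun x _ => ?_
          by_cases hx : x ∈ T
          · rw [rMat_supp S x y (fun hc => hR ⟨x, hx, hc⟩), mul_zero]
          · rw [hb x hx, zero_mul]
        rw [this, zero_mul]
    have hb0 : b = 0 := Matrix.eq_zero_of_vecMul_eq_zero (rMat_det S) hw0
    funext ⟨x, hx⟩
    have := congrFun hb0 x
    simpa [b, hx] using this
  have := card_le_of_injective ℤ M.vecMulLinear hinj
  simpa using this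

/-! ### The inequality for weighted product spaces -/

/-- disjoint occurrence of two events -/
def box2 {n : ℕ} {Ω : Fin n → Type*} (A B : Set (∀ i, Ω i)) : Set (∀ i, Ω i) :=
  {ω | ∃ S S' : Finset (Fin n), Disjoint S S' ∧
    (∀ ω' : ∀ i, Ω i, (∀ i ∈ S, ω' i = ω i) → ω' ∈ A) ∧
    ∀ ω' : ∀ i, Ω i, (∀ i ∈ S', ω' i = ω i) → ω' ∈ B}

/-- mixing two configurations -/
def mixF {n : ℕ} {Ω : Fin n → Type*} (ω ω' : ∀ i, Ω i) (x : Fin n → Bool) : ∀ i, Ω i :=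
  fun i => if x i then ω' i else ω i

/-- the swap as an equivalence -/
def mixE {n : ℕ} {Ω : Fin n → Type*} (x : Fin n → Bool) :
    ((∀ i, Ω i) × (∀ i, Ω i)) ≃ ((∀ i, Ω i) × (∀ i, Ω i)) :=
  Function.Involutive.toPerm
    (fun q => (mixF q.1 q.2 x, mixF q.1 q.2 (fun i => !(x i)))) (by
      rintro ⟨a, b⟩
      ext i
      · cases h : x i <;> simp [mixF, h]
      · cases h : x i <;> simp [mixF, h])

open Classical in
/-- probability -/
noncomputable def prW {n : ℕ} {Ω : Fin n → Type*} [∀ i, Fintype (Ω i)]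
    (p : ∀ i, Ω i → ℝ) (A : Set (∀ i, Ω i)) : ℝ :=
  ∑ ω, if ω ∈ A then ∏ i, p i (ω i) else 0

open Classical in
lemma cube_card {n : ℕ} {Ω : Fin n → Type*} (A B : Set (∀ i, Ω i)) (ω ω' : ∀ i, Ω i) :
    (Finset.univ.filter fun x => mixF ω ω' x ∈ box2 A B).card ≤
    (Finset.univ.filter fun x => mixF ω ω' x ∈ A ∧ mixF ω ω' (fun i => !(x i)) ∈ B).card := by
  have h : ∀ x : Fin n → Bool, ∃ S : Finset (Fin n), mixF ω ω' x ∈ box2 A B →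
      (∀ y : Fin n → Bool, (∀ i ∈ S, y i = x i) → mixF ω ω' y ∈ A) ∧
      (∀ y : Fin n → Bool, (∀ i, i ∉ S → y i = x i) → mixF ω ω' y ∈ B) := by
    intro x
    by_cases hx : mixF ω ω' x ∈ box2 A B
    · obtain ⟨S, S', hd, hA, hB⟩ := hx
      refine ⟨S, fun _ => ⟨fun y hy => hA _ fun i hi => ?_, fun y hy => hB _ fun i hi => ?_⟩⟩
      · simp [mixF, hy i hi]
      · simp [mixF, hy i (fun h => Finset.disjoint_left.mp hd h hi)]
    · exact ⟨∅, fun h => absurd h hx⟩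
  choose S hS using h
  apply butterfly _ S
  rintro y ⟨x, hx, hxy⟩ ⟨x', hx', hxy'⟩
  rw [Finset.mem_filter] at hx hx' ⊢
  refine ⟨Finset.mem_univ _, (hS x hx.2).1 y hxy, (hS x' hx'.2).2 _ fun i hi => ?_⟩
  rw [hxy' i hi, Bool.not_not]

lemma mix_weight {n : ℕ} {Ω : Fin n → Type*} (p : ∀ i, Ω i → ℝ) (ω ω' : ∀ i, Ω i)
    (x : Fin n → Bool) :
    (∏ i, p i (mixF ω ω' x i)) * ∏ i, p i (mixF ω ω' (fun i => !(x i)) i)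
      = (∏ i, p i (ω i)) * ∏ i, p i (ω' i) := by
  rw [← Finset.prod_mul_distrib, ← Finset.prod_mul_distrib]
  refine Finset.prod_congr rfl fun i _ => ?_
  cases h : x i <;> simp [mixF, h, mul_comm]

open Classical in
lemma mix_sum {n : ℕ} {Ω : Fin n → Type*} [∀ i, Fintype (Ω i)] (p : ∀ i, Ω i → ℝ)
    (A B : Set (∀ i, Ω i)) :
    (2 : ℝ) ^ n * (prW p A * prW p B) =
      ∑ q : (∀ i, Ω i) × (∀ i, Ω i), ((∏ i, p i (q.1 i)) * ∏ i, p i (q.2 i)) *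
        ((Finset.univ.filter fun x : Fin n → Bool =>
          mixF q.1 q.2 x ∈ A ∧ mixF q.1 q.2 (fun i => !(x i)) ∈ B).card : ℝ) := by
  have h0 : prW p A * prW p B = ∑ q : (∀ i, Ω i) × (∀ i, Ω i),
      ((∏ i, p i (q.1 i)) * ∏ i, p i (q.2 i)) * if q.1 ∈ A ∧ q.2 ∈ B then 1 else 0 := by
    rw [prW, prW, Finset.sum_mul_sum, Fintype.sum_prod_type]
    refine Finset.sum_congr rfl fun a _ => Finset.sum_congr rfl fun b _ => ?_
    by_cases ha : a ∈ A <;> by_cases hb : b ∈ B <;> simp [ha, hb]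
  have h1 : ∀ x : Fin n → Bool, prW p A * prW p B = ∑ q : (∀ i, Ω i) × (∀ i, Ω i),
      ((∏ i, p i (q.1 i)) * ∏ i, p i (q.2 i)) *
        if mixF q.1 q.2 x ∈ A ∧ mixF q.1 q.2 (fun i => !(x i)) ∈ B then 1 else 0 := by
    intro x
    rw [h0, ← Equiv.sum_comp (mixE x)]
    refine Finset.sum_congr rfl fun q _ => ?_
    rw [← mix_weight p q.1 q.2 x]
    rfl
  have h2 : (2 : ℝ) ^ n * (prW p A * prW p B) = ∑ _x : Fin n → Bool, prW p A * prW p B := by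
    simp
  rw [h2]
  calc _ = ∑ x : Fin n → Bool, ∑ q : (∀ i, Ω i) × (∀ i, Ω i),
      ((∏ i, p i (q.1 i)) * ∏ i, p i (q.2 i)) *
        (if mixF q.1 q.2 x ∈ A ∧ mixF q.1 q.2 (fun i => !(x i)) ∈ B then (1 : ℝ) else 0) :=
        Finset.sum_congr rfl fun x _ => h1 x
    _ = _ := by
      rw [Finset.sum_comm]
      refine Finset.sum_congr rfl fun q _ => ?_
      rw [← Finset.mul_sum, Finset.sum_boole]

lemma prW_univ {n : ℕ} {Ω : Fin n → Type*} [∀ i, Fintype (Ω i)]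
    (p : ∀ i, Ω i → ℝ) (hp1 : ∀ i, ∑ a, p i a = 1) : prW p Set.univ = 1 := by
  classical
  simp [prW, ← Fintype.prod_sum, hp1]

theorem reimer {n : ℕ} {Ω : Fin n → Type*} [∀ i, Fintype (Ω i)]
    (p : ∀ i, Ω i → ℝ) (hp : ∀ i a, 0 ≤ p i a) (hp1 : ∀ i, ∑ a, p i a = 1)
    (A B : Set (∀ i, Ω i)) : prW p (box2 A B) ≤ prW p A * prW p B := by
  classical
  have h1 := mix_sum p (box2 A B) Set.univ
  have h2 := mix_sum p A B
  rw [prW_univ p hp1, mul_one] at h1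
  have h3 : (2 : ℝ) ^ n * prW p (box2 A B) ≤ (2 : ℝ) ^ n * (prW p A * prW p B) := by
    rw [h1, h2]
    refine Finset.sum_le_sum fun q _ => ?_
    refine mul_le_mul_of_nonneg_left ?_ (mul_nonneg (Finset.prod_nonneg fun i _ => hp _ _)
      (Finset.prod_nonneg fun i _ => hp _ _))
    have := cube_card A B q.1 q.2
    simp only [Set.mem_univ, and_true]
    exact_mod_cast this
  exact le_of_mul_le_mul_left h3 (by positivity)

lemma prW_mono {n : ℕ} {Ω : Fin n → Type*} [∀ i, Fintype (Ω i)]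
    (p : ∀ i, Ω i → ℝ) (hp : ∀ i a, 0 ≤ p i a)
    {A B : Set (∀ i, Ω i)} (h : A ⊆ B) : prW p A ≤ prW p B := by
  classical
  refine Finset.sum_le_sum fun ω _ => ?_
  have hw : 0 ≤ ∏ i, p i (ω i) := Finset.prod_nonneg fun i _ => hp _ _
  by_cases ha : ω ∈ A
  · simp [ha, h ha]
  · simp only [ha, if_false]
    split_ifs
    · exact hw
    · exact le_rfl

lemma prW_nonneg {n : ℕ} {Ω : Fin n → Type*} [∀ i, Fintype (Ω i)]
    (p : ∀ i, Ω i → ℝ) (hp : ∀ i a, 0 ≤ p i a)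
    (A : Set (∀ i, Ω i)) : 0 ≤ prW p A := by
  classical
  refine Finset.sum_nonneg fun ω _ => ?_
  have hw : 0 ≤ ∏ i, p i (ω i) := Finset.prod_nonneg fun i _ => hp _ _
  split_ifs
  · exact hw
  · exact le_rfl

theorem reimer_multi {n : ℕ} {Ω : Fin n → Type*} [∀ i, Fintype (Ω i)] {ι : Type*}
    (p : ∀ i, Ω i → ℝ) (hp : ∀ i a, 0 ≤ p i a) (hp1 : ∀ i, ∑ a, p i a = 1)
    (A : ι → Set (∀ i, Ω i)) (I : Finset ι) :
    prW p {ω | OccurDisjointly A I ω} ≤ ∏ j ∈ I, prW p (A j) := by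
  classical
  induction I using Finset.induction_on with
  | empty =>
    rw [Finset.prod_empty, ← prW_univ p hp1]
    exact prW_mono p hp (Set.subset_univ _)
  | insert j I hj ih =>
    rw [Finset.prod_insert hj]
    have hsub : {ω | OccurDisjointly A (insert j I) ω} ⊆
        box2 (A j) {ω | OccurDisjointly A I ω} := by
      rintro ω ⟨S, hd, hS⟩
      refine ⟨S j, I.biUnion S, ?_, hS j (Finset.mem_insert_self _ _), ?_⟩
      · rw [Finset.disjoint_biUnion_right]
        intro i hi
        exact hd j (Finset.mem_insert_self _ _) i (Finset.mem_insert_of_mem hi)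
          (fun h => hj (h ▸ hi))
      · intro ω' hω'
        refine ⟨S, fun a ha b hb => hd a (Finset.mem_insert_of_mem ha) b
          (Finset.mem_insert_of_mem hb), fun a ha ω'' h'' => ?_⟩
        refine hS a (Finset.mem_insert_of_mem ha) ω'' fun i hi => ?_
        rw [h'' i hi, hω' i (Finset.mem_biUnion.mpr ⟨a, ha, hi⟩)]
    calc _ ≤ _ := prW_mono p hp hsub
      _ ≤ _ := reimer p hp hp1 _ _
      _ ≤ _ := mul_le_mul_of_nonneg_left ih (prW_nonneg p hp _)

lemma occ_mono {n : ℕ} {Ω : Fin n → Type*} {ι : Type*}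
    (A : ι → Set (∀ i, Ω i)) {I J : Finset ι} (h : J ⊆ I) (ω : ∀ i, Ω i)
    (hI : OccurDisjointly A I ω) : OccurDisjointly A J ω := by
  obtain ⟨S, hd, hS⟩ := hI
  exact ⟨S, fun a ha b hb => hd a (h ha) b (h hb), fun a ha => hS a (h ha)⟩

lemma exists_max {n k : ℕ} {Ω : Fin n → Type*}
    (A : Fin k → Set (∀ i, Ω i)) (ω : ∀ i, Ω i) :
    ∃ I : Finset (Fin k), I.card = maxDisjOcc A ω ∧ OccurDisjointly A I ω := by
  have := Nat.sSup_mem (s := {m : ℕ | ∃ I : Finset (Fin k), I.card = m ∧ OccurDisjointly A I ω})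
    ⟨0, ∅, rfl, fun _ => ∅, by simp, by simp⟩
    ⟨k, by rintro m ⟨I, rfl, -⟩; simpa using I.card_le_univ⟩
  exact this

open Classical in
lemma descFactorial_le {n k : ℕ} {Ω : Fin n → Type*}
    (A : Fin k → Set (∀ i, Ω i)) (ω : ∀ i, Ω i) (t : ℕ) :
    (maxDisjOcc A ω).descFactorial t ≤
      (Finset.univ.filter fun f : Fin t ↪ Fin k =>
        OccurDisjointly A (Finset.univ.map f) ω).card := by
  obtain ⟨I, hI, hocc⟩ := exists_max A ω
  have h1 : (maxDisjOcc A ω).descFactorial t = Fintype.card (Fin t ↪ I) := by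
    rw [Fintype.card_embedding_eq, Fintype.card_coe, hI, Fintype.card_fin]
  rw [h1, ← Finset.card_univ]
  apply Finset.card_le_card_of_injOn
    (fun f : Fin t ↪ I => f.trans (Function.Embedding.subtype _))
  · intro f _
    simp only [Finset.coe_filter, Finset.mem_univ, true_and, Set.mem_ofPred_eq]
    refine occ_mono A ?_ ω hocc
    intro a ha
    rw [Finset.mem_map] at ha
    obtain ⟨b, -, rfl⟩ := ha
    exact (f b).2
  · intro f _ g _ hfg
    ext b
    exact congrArg Fin.val (DFunLike.congr_fun hfg b)

theorem factorial_moment {n k : ℕ} {Ω : Fin n → Type*} [∀ i, Fintype (Ω i)]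
    (p : ∀ i, Ω i → ℝ) (hp : ∀ i a, 0 ≤ p i a) (hp1 : ∀ i, ∑ a, p i a = 1)
    (A : Fin k → Set (∀ i, Ω i)) (t : ℕ) :
    ∑ ω, (∏ i, p i (ω i)) * ((maxDisjOcc A ω).descFactorial t : ℝ)
      ≤ (∑ j, prW p (A j)) ^ t := by
  classical
  calc _ ≤ ∑ ω, (∏ i, p i (ω i)) * ∑ f : Fin t ↪ Fin k,
        (if OccurDisjointly A (Finset.univ.map f) ω then (1 : ℝ) else 0) := by
        refine Finset.sum_le_sum fun ω _ => mul_le_mul_of_nonneg_left ?_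
          (Finset.prod_nonneg fun i _ => hp _ _)
        rw [Finset.sum_boole]
        exact_mod_cast descFactorial_le A ω t
    _ = ∑ f : Fin t ↪ Fin k, prW p {ω | OccurDisjointly A (Finset.univ.map f) ω} := by
        simp_rw [Finset.mul_sum]
        rw [Finset.sum_comm]
        refine Finset.sum_congr rfl fun f _ => Finset.sum_congr rfl fun ω _ => ?_
        simp
    _ ≤ ∑ f : Fin t ↪ Fin k, ∏ i, prW p (A (f i)) := by
        refine Finset.sum_le_sum fun f _ => ?_
        have := reimer_multi p hp hp1 A (Finset.univ.map f)
        rwa [Finset.prod_map] at this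
    _ ≤ ∑ f : Fin t → Fin k, ∏ i, prW p (A (f i)) := by
        have : ∑ f : Fin t ↪ Fin k, ∏ i, prW p (A (f i)) =
            ∑ f ∈ Finset.univ.map ⟨fun f : Fin t ↪ Fin k => (f : Fin t → Fin k),
              DFunLike.coe_injective⟩, ∏ i, prW p (A (f i)) := by
          rw [Finset.sum_map]; rfl
        rw [this]
        exact Finset.sum_le_sum_of_subset_of_nonneg (Finset.subset_univ _)
          fun f _ _ => Finset.prod_nonneg fun i _ => prW_nonneg p hp _
    _ = _ := by
        rw [← Fintype.prod_sum (fun (_ : Fin t) j => prW p (A j))]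
        simp

lemma pi_toReal {n : ℕ} {Ω : Fin n → Type*}
    [∀ i, Fintype (Ω i)]
    [∀ i, MeasurableSpace (Ω i)] [∀ i, MeasurableSingletonClass (Ω i)]
    (μi : ∀ i, Measure (Ω i)) [∀ i, IsProbabilityMeasure (μi i)] (A : Set (∀ i, Ω i)) :
    (Measure.pi μi A).toReal = prW (fun i a => (μi i {a}).toReal) A := by
  classical
  have h : A = ((Finset.univ.filter fun ω => ω ∈ A : Finset (∀ i, Ω i)) : Set (∀ i, Ω i)) := by
    ext; simp
  conv_lhs => rw [h]
  rw [← sum_measure_singleton, ENNReal.toReal_sum (fun _ _ => measure_ne_top _ _),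
    Finset.sum_filter, prW]
  refine Finset.sum_congr rfl fun ω _ => ?_
  rw [Measure.pi_singleton, ENNReal.toReal_prod]

/-- **Markov-type upper tail bound for disjoint occurrence.** In a finite product
probability space with linearly ordered factors, with `λ = Σ μ(A i)` and `X` the
maximal number of the events `A 1, …, A k` occurring disjointly, for every positive
integer `t ≤ k`, `Pr(X ≥ λ + t) ≤ ∏_{i=0}^{t-1} λ / (λ + t − i)`. -/
theorem disjoint_occurrence_markov_bound
    {n k : ℕ} {Ω : Fin n → Type*}
    [∀ i, Fintype (Ω i)] [∀ i, LinearOrder (Ω i)]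
    [∀ i, MeasurableSpace (Ω i)] [∀ i, MeasurableSingletonClass (Ω i)]
    (μi : ∀ i, Measure (Ω i)) [∀ i, IsProbabilityMeasure (μi i)]
    (A : Fin k → Set (∀ i, Ω i))
    (lam : ℝ) (hlam : lam = ∑ i, (Measure.pi μi (A i)).toReal) :
    ∀ t : ℕ, 0 < t → t ≤ k →
      (Measure.pi μi {ω | lam + t ≤ (maxDisjOcc A ω : ℝ)}).toReal ≤
        ∏ i ∈ Finset.range t, lam / (lam + t - i) := by
  classical
  intro t _ _
  set p : ∀ i, Ω i → ℝ := fun i a => (μi i {a}).toReal with hpdef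
  have hp : ∀ i a, 0 ≤ p i a := fun i a => ENNReal.toReal_nonneg
  have hp1 : ∀ i, ∑ a, p i a = 1 := by
    intro i
    rw [← ENNReal.toReal_sum (fun _ _ => measure_ne_top _ _), sum_measure_singleton]
    simp
  have hl : lam = ∑ j, prW p (A j) := by
    rw [hlam]
    exact Finset.sum_congr rfl fun j _ => pi_toReal μi (A j)
  have hl0 : 0 ≤ lam := by
    rw [hl]
    exact Finset.sum_nonneg fun j _ => prW_nonneg p hp _
  have hpos : ∀ i ∈ Finset.range t, 0 < lam + t - i := by
    intro i hi
    have : (i : ℝ) < t := by exact_mod_cast Finset.mem_range.mp hi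
    linarith
  have hD : 0 < ∏ i ∈ Finset.range t, (lam + t - i) := Finset.prod_pos hpos
  rw [pi_toReal, Finset.prod_div_distrib, Finset.prod_const, Finset.card_range, le_div_iff₀ hD]
  rw [hl] at *
  refine le_trans ?_ (factorial_moment p hp hp1 A t)
  rw [prW, Finset.sum_mul]
  refine Finset.sum_le_sum fun ω _ => ?_
  have hw : 0 ≤ ∏ i, p i (ω i) := Finset.prod_nonneg fun i _ => hp _ _
  split_ifs with hω
  · refine mul_le_mul_of_nonneg_left ?_ hw
    have hω' : (∑ j, prW p (A j)) + t ≤ (maxDisjOcc A ω : ℝ) := hω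
    rw [Nat.descFactorial_eq_prod_range, Nat.cast_prod]
    refine Finset.prod_le_prod (fun i hi => (hpos i hi).le) fun i hi => ?_
    have hit : (i : ℝ) < t := by exact_mod_cast Finset.mem_range.mp hi
    have him : i ≤ maxDisjOcc A ω := by
      have : (i : ℝ) ≤ (maxDisjOcc A ω : ℝ) := by linarith
      exact_mod_cast this
    rw [Nat.cast_sub him]
    linarith
  · rw [zero_mul]
    exact mul_nonneg hw (Nat.cast_nonneg _)
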